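/- (Positive lower uniform bound of the mass matrix.) Let n, N ≥ 1, let J : ℝⁿ → ℝ^{(6N)×n}, and let Θ : [0,∞) → ℝ^{10N} with components Φ_l(t) ∈ ℝ^10 for l = 1,…,N. Suppose there is γ > 0 such that J(q)ᵀJ(q) − γ·I_n is positive semidefinite for all q ∈ ℝⁿ (normality of the Jacobian), and there is ξ > 0 such that f(Φ_l(t)) − ξ·I₄ is positive definite for all t ≥ 0 and all l ∈ {1,…,N} (uniform physical consistency). Then M(q,Θ(t)) − ξγ·I_n is positive semidefinite for all q ∈ ℝⁿ and all t ≥ 0. -/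

import Mathlib

noncomputable section

open Matrix

/-- The skew-symmetric cross-product matrix `𝒮(x)` with `𝒮(x) y = x × y`. -/
def crossMat (x : Fin 3 → ℝ) : Matrix (Fin 3) (Fin 3) ℝ :=
  !![0, -x 2, x 1; x 2, 0, -x 0; -x 1, x 0, 0]

/-- The first moment of mass `h = (h₁,h₂,h₃)` from `Φ`. -/
def hVec (Φ : Fin 10 → ℝ) : Fin 3 → ℝ := ![Φ 1, Φ 2, Φ 3]

/-- The inertia matrix `I` from `Φ = (m,h₁,h₂,h₃,I₁₁,I₂₂,I₃₃,I₁₂,I₂₃,I₁₃)`. -/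
def Imat (Φ : Fin 10 → ℝ) : Matrix (Fin 3) (Fin 3) ℝ :=
  !![Φ 4, Φ 7, Φ 9; Φ 7, Φ 5, Φ 8; Φ 9, Φ 8, Φ 6]

/-- `Σ = (1/2)·tr(I)·I₃ − I`. -/
def SigmaMat (Φ : Fin 10 → ℝ) : Matrix (Fin 3) (Fin 3) ℝ :=
  ((1 / 2 : ℝ) * (Imat Φ).trace) • (1 : Matrix (Fin 3) (Fin 3) ℝ) - Imat Φ

/-- The 4×4 matrix `f(Φ) = [[Σ, h],[hᵀ, m]]`. -/
def fMat (Φ : Fin 10 → ℝ) : Matrix (Fin 3 ⊕ Fin 1) (Fin 3 ⊕ Fin 1) ℝ :=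
  Matrix.fromBlocks (SigmaMat Φ) (Matrix.of fun i _ => hVec Φ i)
    (Matrix.of fun _ j => hVec Φ j) (Matrix.of fun _ _ => Φ 0)

/-- The 6×6 matrix `Z(Φ) = [[m·I₃, −𝒮(h)],[−𝒮(h)ᵀ, I]]`. -/
def ZMat (Φ : Fin 10 → ℝ) : Matrix (Fin 3 ⊕ Fin 3) (Fin 3 ⊕ Fin 3) ℝ :=
  Matrix.fromBlocks (Φ 0 • (1 : Matrix (Fin 3) (Fin 3) ℝ)) (-(crossMat (hVec Φ)))
    (-(crossMat (hVec Φ))ᵀ) (Imat Φ)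

/-- `𝒵(Θ) = blockdiag(Z(Φ₁),…,Z(Φ_N))`. -/
def calZ {N : ℕ} (Θ : Fin N → Fin 10 → ℝ) :
    Matrix ((Fin 3 ⊕ Fin 3) × Fin N) ((Fin 3 ⊕ Fin 3) × Fin N) ℝ :=
  Matrix.blockDiagonal fun l => ZMat (Θ l)

/-- The mass matrix `M(q,Θ) = J(q)ᵀ 𝒵(Θ) J(q)`. -/
def massMatrix {n N : ℕ}
    (J : (Fin n → ℝ) → Matrix ((Fin 3 ⊕ Fin 3) × Fin N) (Fin n) ℝ)
    (Θ : Fin N → Fin 10 → ℝ) (q : Fin n → ℝ) : Matrix (Fin n) (Fin n) ℝ :=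
  (J q)ᵀ * calZ Θ * J q

/-- A block-diagonal matrix with positive semidefinite blocks is positive semidefinite. -/
theorem posSemidef_blockDiagonal {m o : Type*} [Fintype m] [Fintype o] [DecidableEq o]
    {A : o → Matrix m m ℝ} (hA : ∀ k, (A k).PosSemidef) : (blockDiagonal A).PosSemidef := by
  refine .of_dotProduct_mulVec_nonneg ?_ fun x => ?_
  · rw [IsHermitian, blockDiagonal_conjTranspose]
    exact congrArg _ (funext fun k => (hA k).isHermitian)
  · have h : star x ⬝ᵥ blockDiagonal A *ᵥ x =
        ∑ k, star (fun i => x (i, k)) ⬝ᵥ A k *ᵥ (fun i => x (i, k)) := by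
      simp [dotProduct, mulVec, blockDiagonal_apply, Fintype.sum_prod_type, Finset.mul_sum]
      exact Finset.sum_comm
    rw [h]
    exact Finset.sum_nonneg fun k _ => (hA k).dotProduct_mulVec_nonneg _

theorem ZMat_isHermitian (Φ : Fin 10 → ℝ) : (ZMat Φ).IsHermitian := by
  have hI : (Imat Φ)ᴴ = Imat Φ := by
    ext i j
    fin_cases i <;> fin_cases j <;> rfl
  rw [conjTranspose_eq_transpose_of_trivial] at hI
  simp [IsHermitian, ZMat, fromBlocks_transpose, hI, conjTranspose_eq_transpose_of_trivial]

/-- The rows of the 3×4 matrix `[𝒮(ω) | v]` for `x = (v, ω)`. -/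
def twistRow (x : Fin 3 ⊕ Fin 3 → ℝ) (i : Fin 3) : Fin 3 ⊕ Fin 1 → ℝ :=
  Sum.elim (crossMat (x ∘ Sum.inr) i) (fun _ => x (.inl i))

/-- The quadratic form of `Z(Φ)` at `(v, ω)` is `tr (A f(Φ) Aᵀ)` with `A = [𝒮(ω) | v]`. -/
theorem ZMat_quadForm (Φ : Fin 10 → ℝ) (x : Fin 3 ⊕ Fin 3 → ℝ) :
    x ⬝ᵥ ZMat Φ *ᵥ x =
      ∑ i, twistRow x i ⬝ᵥ fMat Φ *ᵥ twistRow x i := by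
  simp [twistRow, ZMat, fMat, SigmaMat, crossMat, hVec, Imat, dotProduct, mulVec, Fin.sum_univ_succ,
    trace, one_apply]
  ring

/-- A lower bound on `f(Φ)` transfers to `Z(Φ)`. -/
theorem ZMat_sub_smul_one_posSemidef {Φ : Fin 10 → ℝ} {ξ : ℝ} (hξ : 0 ≤ ξ)
    (hΦ : (fMat Φ - ξ • (1 : Matrix (Fin 3 ⊕ Fin 1) (Fin 3 ⊕ Fin 1) ℝ)).PosSemidef) :
    (ZMat Φ - ξ • (1 : Matrix (Fin 3 ⊕ Fin 3) (Fin 3 ⊕ Fin 3) ℝ)).PosSemidef := by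
  refine .of_dotProduct_mulVec_nonneg ((ZMat_isHermitian Φ).sub ?_) fun x => ?_
  · simp [IsHermitian]
  have hf (y : Fin 3 ⊕ Fin 1 → ℝ) : ξ * (y ⬝ᵥ y) ≤ y ⬝ᵥ fMat Φ *ᵥ y := by
    simpa [sub_mulVec, smul_mulVec, dotProduct_sub] using hΦ.dotProduct_mulVec_nonneg y
  have hnorm : x ⬝ᵥ x ≤ ∑ i, twistRow x i ⬝ᵥ twistRow x i := by
    simp [twistRow, crossMat, dotProduct, Fin.sum_univ_succ]
    nlinarith [sq_nonneg (x (.inr 0)), sq_nonneg (x (.inr 1)), sq_nonneg (x (.inr 2))]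
  have hZ : ξ * (x ⬝ᵥ x) ≤ x ⬝ᵥ ZMat Φ *ᵥ x := by
    rw [ZMat_quadForm]
    refine (mul_le_mul_of_nonneg_left hnorm hξ).trans ?_
    rw [Finset.mul_sum]
    exact Finset.sum_le_sum fun i _ => hf _
  simpa [sub_mulVec, smul_mulVec, dotProduct_sub] using hZ

/-- Positive lower uniform bound of the mass matrix: if the Jacobian is normal and the
inertial parameters are uniformly physically consistent, then `M(q,Θ(t)) ⪰ ξγ·I_n`. -/
theorem massMatrix_lower_bound {n N : ℕ} (hn : 1 ≤ n) (hN : 1 ≤ N)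
    (J : (Fin n → ℝ) → Matrix ((Fin 3 ⊕ Fin 3) × Fin N) (Fin n) ℝ)
    (Θ : ℝ → Fin N → Fin 10 → ℝ)
    (γ : ℝ) (hγ : 0 < γ)
    (hJ : ∀ q, ((J q)ᵀ * J q - γ • (1 : Matrix (Fin n) (Fin n) ℝ)).PosSemidef)
    (ξ : ℝ) (hξ : 0 < ξ)
    (hΘ : ∀ t, 0 ≤ t → ∀ l,
      (fMat (Θ t l) - ξ • (1 : Matrix (Fin 3 ⊕ Fin 1) (Fin 3 ⊕ Fin 1) ℝ)).PosDef) :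
    ∀ (q : Fin n → ℝ) (t : ℝ), 0 ≤ t →
      (massMatrix J (Θ t) q - (ξ * γ) • (1 : Matrix (Fin n) (Fin n) ℝ)).PosSemidef := by
  intro q t ht
  have hZ : (calZ (Θ t) - ξ • 1).PosSemidef := by
    have h : calZ (Θ t) - ξ • 1 = blockDiagonal fun l => ZMat (Θ t l) - ξ • 1 := by
      rw [calZ, ← blockDiagonal_one, ← blockDiagonal_smul, ← blockDiagonal_sub]
      rfl
    rw [h]
    exact posSemidef_blockDiagonal fun l =>
      ZMat_sub_smul_one_posSemidef hξ.le (hΘ t ht l).posSemidef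
  have hM : massMatrix J (Θ t) q - (ξ * γ) • 1 =
      (J q)ᴴ * (calZ (Θ t) - ξ • 1) * J q + ξ • ((J q)ᵀ * J q - γ • 1) := by
    simp [massMatrix, conjTranspose_eq_transpose_of_trivial, Matrix.mul_sub, Matrix.sub_mul,
      smul_sub, smul_smul]
  rw [hM]
  exact (hZ.conjTranspose_mul_mul_same (J q)).add ((hJ q).smul hξ.le)

end
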